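/- arXiv:2604.24497 — 16 statements merged into one kernel-verified Lean document; each statement's English description precedes it below -/
import Mathlib

section
/- Let R be an integral domain with (2 : R) ≠ 0 (the characteristic of R is not 2) and M a finite rank free R-module with a bilinear form ⟨,⟩ : M × M → R satisfying ⟨x,x⟩ = 0 for all x. If the symplectic quandle (M,*) is a kei, then (M,*) is a trivial quandle, i.e. ⟨x,y⟩ = 0 for all x,y ∈ M. -/
/-- If `R` is an integral domain of characteristic not 2 and the symplectic
quandle `(M,*)` is a kei, then `(M,*)` is a trivial quandle, i.e. `⟨x,y⟩ = 0` for all `x,y`. -/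
theorem symplectic_quandle_trivial_of_kei_of_char_ne_two
    (R : Type*) [CommRing R] [IsDomain R] (M : Type*) [AddCommGroup M] [Module R M]
    [Module.Free R M] [Module.Finite R M]
    (B : M →ₗ[R] M →ₗ[R] R) (halt : ∀ x : M, B x x = 0)
    (hchar : (2 : R) ≠ 0)
    (hkei : ∀ x y : M, x + B x y • y = x - B x y • y) :
    ∀ x y : M, B x y = 0 := by
  intro x y
  have h := congrArg (B x) (hkei x y)
  simp only [map_add, map_sub, map_smul, smul_eq_mul, halt] at h
  have h2 : (2 : R) * (B x y * B x y) = 0 := by linear_combination h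
  exact mul_self_eq_zero.mp ((mul_eq_zero.mp h2).resolve_left hchar)
end

section
/- Let R be an integral domain and M a finite rank free R-module with a bilinear form ⟨,⟩ : M × M → R satisfying ⟨x,x⟩ = 0 for all x, such that the symplectic quandle (M,*) is nontrivial (there exist x,y ∈ M with ⟨x,y⟩ ≠ 0). Then (M,*) is a kei if and only if (2 : R) = 0 (the characteristic of R is 2). -/
/-- A nontrivial symplectic quandle over an integral domain `R` is a kei
if and only if the characteristic of `R` is 2. -/
theorem symplectic_quandle_kei_iff_char_two
    (R : Type*) [CommRing R] [IsDomain R] (M : Type*) [AddCommGroup M] [Module R M]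
    [Module.Free R M] [Module.Finite R M]
    (B : M →ₗ[R] M →ₗ[R] R) (halt : ∀ x : M, B x x = 0)
    (hnontriv : ∃ x y : M, B x y ≠ 0) :
    (∀ x y : M, x + B x y • y = x - B x y • y) ↔ (2 : R) = 0 := by
  constructor
  · intro hkei
    obtain ⟨x, y, hxy⟩ := hnontriv
    have h := congrArg (B x) (hkei x y)
    simp only [map_add, map_sub, map_smul, halt, smul_eq_mul] at h
    have h2 : (2 : R) * (B x y * B x y) = 0 := by linear_combination h
    exact (mul_eq_zero.mp h2).resolve_right (mul_ne_zero hxy hxy)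
  · intro h2 x y
    have h : B x y • y + B x y • y = 0 := by
      rw [← two_smul R, h2, zero_smul]
    rw [sub_eq_add_neg, ← eq_neg_of_add_eq_zero_left h]
end

section
/- Let R be an integral domain and M a finite rank free R-module with a bilinear form ⟨,⟩ : M × M → R satisfying ⟨x,x⟩ = 0 for all x. Let ρ : M → M be an R-linear involution. If ρ satisfies ρ(x*y) = ρ(x)*y for all x,y ∈ M, or if ρ satisfies x*ρ(y) = x*⁻¹y for all x,y ∈ M, then ⟨ρ(x),x⟩ = 0 for all x ∈ M. -/
/-- If an `R`-linear involution `ρ` of a symplectic quandle over an integral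
domain satisfies either the first condition `ρ(x*y) = ρ(x)*y` or the second condition
`x*ρ(y) = x*⁻¹y` of good involutions, then `⟨ρ(x),x⟩ = 0` for all `x`. -/
theorem linear_semi_good_involution_pairing_zero
    (R : Type*) [CommRing R] [IsDomain R] (M : Type*) [AddCommGroup M] [Module R M]
    [Module.Free R M] [Module.Finite R M]
    (B : M →ₗ[R] M →ₗ[R] R) (halt : ∀ x : M, B x x = 0)
    (ρ : M →ₗ[R] M) (hinv : ∀ x : M, ρ (ρ x) = x)
    (hcond : (∀ x y : M, ρ (x + B x y • y) = ρ x + B (ρ x) y • y) ∨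
             (∀ x y : M, x + B x (ρ y) • ρ y = x - B x y • y)) :
    ∀ x : M, B (ρ x) x = 0 := by
  intro x
  rcases hcond with h | h
  · have hx : B (ρ x) x • x = 0 := by simpa [halt] using h x x
    rcases smul_eq_zero.mp hx with h0 | rfl
    · exact h0
    · simp
  · have hx : B x (ρ x) • ρ x = 0 := by simpa [halt] using h x x
    rcases smul_eq_zero.mp hx with h0 | h0
    · rw [← LinearMap.IsAlt.neg halt, h0, neg_zero]
    · simp [h0]
end

section
/- Let R be an integral domain and M a finite rank free R-module with a bilinear form ⟨,⟩ : M × M → R satisfying ⟨x,x⟩ = 0 for all x. If ρ : M → M is an R-linear involution satisfying ρ(x*y) = ρ(x)*y for all x,y ∈ M, then ⟨ρ(x),ρ(y)⟩ = ⟨x,y⟩ for all x,y ∈ M, i.e. ρ is a symplectic involution. -/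
/-- If an `R`-linear involution `ρ` of a symplectic quandle over an integral
domain satisfies the first condition of good involutions, `ρ(x*y) = ρ(x)*y`, then `ρ` is a
symplectic involution: `⟨ρ(x),ρ(y)⟩ = ⟨x,y⟩`. -/
theorem linear_first_condition_implies_symplectic
    (R : Type*) [CommRing R] [IsDomain R] (M : Type*) [AddCommGroup M] [Module R M]
    [Module.Free R M] [Module.Finite R M]
    (B : M →ₗ[R] M →ₗ[R] R) (halt : ∀ x : M, B x x = 0)
    (ρ : M →ₗ[R] M) (hinv : ∀ x : M, ρ (ρ x) = x)
    (hcond1 : ∀ x y : M, ρ (x + B x y • y) = ρ x + B (ρ x) y • y) :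
    ∀ x y : M, B (ρ x) (ρ y) = B x y := by
  have hsmul (x y : M) : B x y • ρ y = B (ρ x) y • y := by
    simpa using hcond1 x y
  have hne (x y : M) (h : B x y ≠ 0) : B (ρ x) (ρ y) = B x y := by
    have h₁ : B x y * B x (ρ y) = B (ρ x) y * B x y := by
      simpa using congrArg (B x) (hsmul x y)
    have h₂ : B x y * B x y = B (ρ x) y * B x (ρ y) := by
      simpa [hinv] using congrArg (fun z => B x (ρ z)) (hsmul x y)
    have h₃ : B x y * B (ρ x) (ρ y) = B (ρ x) y * B (ρ x) y := by
      simpa using congrArg (B (ρ x)) (hsmul x y)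
    have h₄ : B x (ρ y) = B (ρ x) y := mul_left_cancel₀ h (by rw [h₁, mul_comm])
    exact mul_left_cancel₀ h (by rw [h₃, h₂, h₄])
  intro x y
  by_cases h : B x y = 0
  · by_contra h'
    have := hne (ρ x) (ρ y) (fun h₀ => h' (h₀.trans h.symm))
    rw [hinv, hinv] at this
    exact h' this.symm
  · exact hne x y h
end

section
/- Let R be an integral domain and M a finite rank free R-module with a bilinear form ⟨,⟩ : M × M → R satisfying ⟨x,x⟩ = 0 for all x. If ρ : M → M is an R-linear involution satisfying both ρ(x*y) = ρ(x)*y and x*ρ(y) = x*⁻¹y for all x,y ∈ M (i.e. ρ is an R-linear good involution of (M,*)), then ⟨ρ(x),ρ(y)⟩ = −⟨x,y⟩ for all x,y ∈ M, i.e. ρ is an anti-symplectic involution. -/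
/-- If an `R`-linear involution `ρ` of a symplectic quandle over an integral
domain is a good involution, then `ρ` is an anti-symplectic involution:
`⟨ρ(x),ρ(y)⟩ = -⟨x,y⟩`. -/
theorem linear_good_involution_is_anti_symplectic
    (R : Type*) [CommRing R] [IsDomain R] (M : Type*) [AddCommGroup M] [Module R M]
    [Module.Free R M] [Module.Finite R M]
    (B : M →ₗ[R] M →ₗ[R] R) (halt : ∀ x : M, B x x = 0)
    (ρ : M →ₗ[R] M) (hinv : ∀ x : M, ρ (ρ x) = x)
    (hcond1 : ∀ x y : M, ρ (x + B x y • y) = ρ x + B (ρ x) y • y)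
    (hcond2 : ∀ x y : M, x + B x (ρ y) • ρ y = x - B x y • y) :
    ∀ x y : M, B (ρ x) (ρ y) = -B x y := by
  intro x y
  by_cases hy : y = 0
  · simp [hy]
  have hρy : ρ y ≠ 0 := fun h => hy (by rw [← hinv y, h, map_zero])
  have h1 : B x y • ρ y = B (ρ x) y • y := by
    simpa only [map_add, map_smul, add_right_inj] using hcond1 x y
  have h2 : B (ρ x) (ρ y) • ρ y = -(B (ρ x) y • y) := by
    simpa only [sub_eq_add_neg, add_right_inj] using hcond2 (ρ x) y
  have h3 : (B (ρ x) (ρ y) + B x y) • ρ y = 0 := by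
    rw [add_smul, h2, h1, neg_add_cancel]
  exact eq_neg_of_add_eq_zero_left ((smul_eq_zero.mp h3).resolve_right hρy)
end

section
/- Let R be an integral domain with (2 : R) ≠ 0 (the characteristic of R is not 2) and M a finite rank free R-module with a bilinear form ⟨,⟩ : M × M → R satisfying ⟨x,x⟩ = 0 for all x. If there exists an R-linear good involution ρ : M → M of the symplectic quandle (M,*), then (M,*) is a trivial quandle, i.e. ⟨x,y⟩ = 0 for all x,y ∈ M. -/
/-- If `R` is an integral domain of characteristic not 2 and there exists an
`R`-linear good involution of the symplectic quandle `(M,*)`, then `(M,*)` is a trivial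
quandle: `⟨x,y⟩ = 0` for all `x,y`. -/
theorem trivial_of_linear_good_involution_char_ne_two
    (R : Type*) [CommRing R] [IsDomain R] (M : Type*) [AddCommGroup M] [Module R M]
    [Module.Free R M] [Module.Finite R M]
    (B : M →ₗ[R] M →ₗ[R] R) (halt : ∀ x : M, B x x = 0)
    (hchar : (2 : R) ≠ 0)
    (hexists : ∃ ρ : M →ₗ[R] M, (∀ x : M, ρ (ρ x) = x) ∧
      (∀ x y : M, ρ (x + B x y • y) = ρ x + B (ρ x) y • y) ∧
      (∀ x y : M, x + B x (ρ y) • ρ y = x - B x y • y)) :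
    ∀ x y : M, B x y = 0 := by
  obtain ⟨ρ, hinv, -, hdual⟩ := hexists
  intro x y
  have h : B x (ρ y) • ρ y = -(B x y • y) := by
    have := hdual x y
    rwa [sub_eq_add_neg, add_right_inj] at this
  have hρ : B x (ρ y) • y = -(B x y • ρ y) := by
    simpa [hinv] using congrArg ρ h
  have hsq : B x (ρ y) * B x (ρ y) = -(B x y * B x y) := by
    simpa using congrArg (B x) h
  have hmul : B x (ρ y) * B x y = -(B x y * B x (ρ y)) := by
    simpa using congrArg (B x) hρ
  have hzero : 2 * (B x y * B x (ρ y)) = 0 := by linear_combination hmul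
  rcases mul_eq_zero.mp ((mul_eq_zero.mp hzero).resolve_left hchar) with h0 | h0
  · exact h0
  · simpa [h0] using hsq
end

section
/- Let R be an integral domain and M a finite rank free R-module with a bilinear form ⟨,⟩ : M × M → R satisfying ⟨x,x⟩ = 0 for all x, such that the symplectic quandle (M,*) is nontrivial (there exist x,y ∈ M with ⟨x,y⟩ ≠ 0). Then there exists an R-linear good involution of (M,*) if and only if (2 : R) = 0 (the characteristic of R is 2). -/
/-- For a nontrivial symplectic quandle over an integral domain `R`, there
exists an `R`-linear good involution if and only if the characteristic of `R` is 2. -/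
theorem linear_good_involution_iff_char_two
    (R : Type*) [CommRing R] [IsDomain R] (M : Type*) [AddCommGroup M] [Module R M]
    [Module.Free R M] [Module.Finite R M]
    (B : M →ₗ[R] M →ₗ[R] R) (halt : ∀ x : M, B x x = 0)
    (hnontriv : ∃ x y : M, B x y ≠ 0) :
    (∃ ρ : M →ₗ[R] M, (∀ x : M, ρ (ρ x) = x) ∧
      (∀ x y : M, ρ (x + B x y • y) = ρ x + B (ρ x) y • y) ∧
      (∀ x y : M, x + B x (ρ y) • ρ y = x - B x y • y)) ↔ (2 : R) = 0 := by
  constructor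
  · rintro ⟨ρ, hinv, -, hdual⟩
    obtain ⟨x, y, hxy⟩ := hnontriv
    have hy : B x (ρ y) • ρ y = -(B x y • y) := by
      have h := hdual x y
      rwa [sub_eq_add_neg, add_right_inj] at h
    have hρy : B x (ρ y) • y = -(B x y • ρ y) := by
      have h := congrArg ρ hy
      rwa [map_neg, map_smul, map_smul, hinv] at h
    have hsq : B x (ρ y) * B x (ρ y) = -(B x y * B x y) := by
      simpa using congrArg (B x) hy
    have hmul : B x (ρ y) * B x y = -(B x y * B x (ρ y)) := by
      simpa using congrArg (B x) hρy
    have hne : B x (ρ y) ≠ 0 := by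
      intro h0
      rw [h0, mul_zero, eq_comm, neg_eq_zero] at hsq
      exact hxy (mul_self_eq_zero.mp hsq)
    have h2 : (2 : R) * (B x y * B x (ρ y)) = 0 := by linear_combination hmul
    exact (mul_eq_zero.mp h2).resolve_right (mul_ne_zero hxy hne)
  · intro h2
    refine ⟨LinearMap.id, fun x => rfl, fun x y => rfl, fun x y => ?_⟩
    have h : (2 : R) • (B x y • y) = 0 := by rw [h2, zero_smul]
    rw [two_smul] at h
    rw [LinearMap.id_apply, sub_eq_add_neg, ← eq_neg_of_add_eq_zero_left h]
end

section
/- Let R be an integral domain with (2 : R) = 0 (the characteristic of R is 2) and M a finite rank free R-module with a nondegenerate bilinear form ⟨,⟩ : M × M → R satisfying ⟨x,x⟩ = 0 for all x. Then every good involution ρ : M → M of the symplectic quandle (M,*) satisfies ρ(0) = 0. -/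
/-- If `R` is an integral domain of characteristic 2 and the antisymmetric
bilinear form on `M` is nondegenerate, then every good involution of the symplectic
quandle `(M,*)` sends `0` to `0`. -/
theorem good_involution_maps_zero_to_zero_char_two
    (R : Type*) [CommRing R] [IsDomain R] (M : Type*) [AddCommGroup M] [Module R M]
    [Module.Free R M] [Module.Finite R M]
    (B : M →ₗ[R] M →ₗ[R] R) (halt : ∀ x : M, B x x = 0)
    (hchar : (2 : R) = 0)
    (hnondeg : ∀ x : M, (∀ y : M, B x y = 0) → x = 0)
    (ρ : M → M) (hinv : ∀ x : M, ρ (ρ x) = x)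
    (hcond1 : ∀ x y : M, ρ (x + B x y • y) = ρ x + B (ρ x) y • y)
    (hcond2 : ∀ x y : M, x + B x (ρ y) • ρ y = x - B x y • y) :
    ρ 0 = 0 := by
  refine hnondeg _ fun y => ?_
  have h : B (ρ 0) y • y = 0 := by simpa using hcond1 0 y
  rcases smul_eq_zero.mp h with h | rfl
  · exact h
  · exact map_zero _
end

section
/- Let R be an integral domain with (2 : R) = 0 (the characteristic of R is 2) and M a finite rank free R-module with a nondegenerate bilinear form ⟨,⟩ : M × M → R satisfying ⟨x,x⟩ = 0 for all x. Then for every good involution ρ : M → M of the symplectic quandle (M,*) and every nonzero y ∈ M, there exist c, d ∈ R with c ≠ 0 such that c • ρ(y) = d • y (i.e. ρ(y) is a scalar multiple of y over the fraction field of R). -/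
/-- If `R` is an integral domain of characteristic 2 and the antisymmetric
bilinear form on `M` is nondegenerate, then for every good involution `ρ` of the symplectic
quandle `(M,*)` and every nonzero `y ∈ M`, the element `ρ(y)` is a scalar multiple of `y`
over the fraction field: there exist `c d : R`, `c ≠ 0`, with `c • ρ(y) = d • y`. -/
theorem good_involution_scalar_multiple_char_two
    (R : Type*) [CommRing R] [IsDomain R] (M : Type*) [AddCommGroup M] [Module R M]
    [Module.Free R M] [Module.Finite R M]
    (B : M →ₗ[R] M →ₗ[R] R) (halt : ∀ x : M, B x x = 0)
    (hchar : (2 : R) = 0)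
    (hnondeg : ∀ x : M, (∀ y : M, B x y = 0) → x = 0)
    (ρ : M → M) (hinv : ∀ x : M, ρ (ρ x) = x)
    (hcond1 : ∀ x y : M, ρ (x + B x y • y) = ρ x + B (ρ x) y • y)
    (hcond2 : ∀ x y : M, x + B x (ρ y) • ρ y = x - B x y • y) :
    ∀ y : M, y ≠ 0 → ∃ c d : R, c ≠ 0 ∧ c • ρ y = d • y := by
  intro y hy
  obtain ⟨x, hx⟩ : ∃ x, B y x ≠ 0 := by
    by_contra! h
    exact hy (hnondeg y h)
  have hxy : B x y = -B y x := by
    have h := halt (x + y)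
    simp only [map_add, LinearMap.add_apply, halt, zero_add, add_zero] at h
    linear_combination h
  have hρ : B x (ρ y) • ρ y = -B x y • y := by
    have h := hcond2 x y
    rw [sub_eq_add_neg, ← neg_smul] at h
    exact add_left_cancel h
  refine ⟨B x (ρ y), -B x y, fun hc => ?_, hρ⟩
  rw [hc, zero_smul, hxy, neg_neg] at hρ
  have h : B (B y x • y) x = 0 := by rw [← hρ, map_zero, LinearMap.zero_apply]
  rw [map_smul, LinearMap.smul_apply, smul_eq_mul] at h
  exact hx (mul_self_eq_zero.mp h)
end

section
/- Let R be an integral domain with (2 : R) = 0 (the characteristic of R is 2) and M a finite rank free R-module with a nondegenerate bilinear form ⟨,⟩ : M × M → R satisfying ⟨x,x⟩ = 0 for all x. Then the identity map of M is the only good involution of the symplectic quandle (M,*): every good involution ρ satisfies ρ(x) = x for all x ∈ M. -/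
/-- If `R` is an integral domain of characteristic 2 and the antisymmetric
bilinear form on `M` is nondegenerate, then the identity map is the only good involution
of the symplectic quandle `(M,*)`. -/
theorem good_involution_is_identity_char_two
    (R : Type*) [CommRing R] [IsDomain R] (M : Type*) [AddCommGroup M] [Module R M]
    [Module.Free R M] [Module.Finite R M]
    (B : M →ₗ[R] M →ₗ[R] R) (halt : ∀ x : M, B x x = 0)
    (hchar : (2 : R) = 0)
    (hnondeg : ∀ x : M, (∀ y : M, B x y = 0) → x = 0)
    (ρ : M → M) (hinv : ∀ x : M, ρ (ρ x) = x)
    (hcond1 : ∀ x y : M, ρ (x + B x y • y) = ρ x + B (ρ x) y • y)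
    (hcond2 : ∀ x y : M, x + B x (ρ y) • ρ y = x - B x y • y) :
    ∀ x : M, ρ x = x := by
  intro y
  have hB : LinearMap.IsAlt B := halt
  have hpair : ∀ x, B x (ρ y) = B x y := by
    intro x
    have h := congrArg (B x) (hcond2 x y)
    simp only [map_add, map_sub, map_smul, smul_eq_mul] at h
    have hsq : (B x (ρ y) - B x y) ^ 2 = 0 := by
      linear_combination h - B x (ρ y) * B x y * hchar
    exact sub_eq_zero.mp (eq_zero_of_pow_eq_zero hsq)
  refine sub_eq_zero.mp (hnondeg _ fun x => ?_)
  rw [← hB.neg, map_sub, hpair, sub_self, neg_zero]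
end

section
/- Let R be a commutative ring with identity and M a finite rank free R-module with a bilinear form ⟨,⟩ : M × M → R satisfying ⟨x,x⟩ = 0 for all x. Suppose (e,f) is a hyperbolic pair of M, i.e. ⟨e,f⟩ = 1. Then for every good involution ρ : M → M of the symplectic quandle (M,*), there exists λ ∈ R such that ρ(e) = λ • e and λ² = −1. -/
/-- If `(e,f)` is a hyperbolic pair of `M` (that is, `⟨e,f⟩ = 1`), then for
every good involution `ρ` of the symplectic quandle `(M,*)` there exists `λ ∈ R` with
`ρ(e) = λ • e` and `λ² = -1`. -/
theorem good_involution_hyperbolic_pair_scalar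
    (R : Type*) [CommRing R] (M : Type*) [AddCommGroup M] [Module R M]
    [Module.Free R M] [Module.Finite R M]
    (B : M →ₗ[R] M →ₗ[R] R) (halt : ∀ x : M, B x x = 0)
    (e f : M) (hef : B e f = 1)
    (ρ : M → M) (hinv : ∀ x : M, ρ (ρ x) = x)
    (hcond1 : ∀ x y : M, ρ (x + B x y • y) = ρ x + B (ρ x) y • y)
    (hcond2 : ∀ x y : M, x + B x (ρ y) • ρ y = x - B x y • y) :
    ∃ l : R, ρ e = l • e ∧ l ^ 2 = -1 := by
  have hfe : B f e = -1 := by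
    have h := halt (e + f)
    simp only [map_add, LinearMap.add_apply, halt, hef] at h
    linear_combination h
  have h : B f (ρ e) • ρ e = e := by
    have h := hcond2 f e
    rw [hfe, neg_one_smul, sub_neg_eq_add] at h
    exact add_left_cancel h
  have hsq : B f (ρ e) * B f (ρ e) = -1 := by
    rw [← smul_eq_mul, ← map_smul, h, hfe]
  refine ⟨-B f (ρ e), ?_, by linear_combination hsq⟩
  calc ρ e = -((B f (ρ e) * B f (ρ e)) • ρ e) := by rw [hsq, neg_one_smul, neg_neg]
    _ = -B f (ρ e) • e := by rw [mul_smul, h, neg_smul]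
end

section
/- Let R be a commutative ring with identity such that (2 : R) ≠ 0 (the characteristic of R is not 2), and let M be a finite rank free R-module with a bilinear form ⟨,⟩ : M × M → R satisfying ⟨x,x⟩ = 0 for all x. If there exists a hyperbolic pair of M, i.e. elements e,f ∈ M with ⟨e,f⟩ = 1, then there exists no good involution of the symplectic quandle (M,*). -/
section SymplecticQuandle

variable {R : Type*} [CommRing R] {M : Type*} [AddCommGroup M] [Module R M]
  {B : M →ₗ[R] M →ₗ[R] R} {ρ : M → M}

/-- A good involution multiplies each member of a hyperbolic pair by a square root of `-1`. -/
lemma exists_eq_smul_of_hyperbolic_pair (halt : B.IsAlt)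
    (hdual : ∀ x y : M, x + B x (ρ y) • ρ y = x - B x y • y)
    {e f : M} (hef : B e f = 1) : ∃ c : R, c * c = -1 ∧ ρ e = c • e := by
  have hfe : B f e = -1 := by rw [← halt.neg e f, hef]
  have h : B f (ρ e) • ρ e = e := by
    have := hdual f e
    rwa [sub_eq_add_neg, add_right_inj, hfe, neg_smul, one_smul, neg_neg] at this
  have hsq : B f (ρ e) * B f (ρ e) = -1 := by
    simpa [hfe] using congrArg (B f) h
  refine ⟨-B f (ρ e), by rw [neg_mul_neg, hsq], ?_⟩
  calc ρ e = -((B f (ρ e) * B f (ρ e)) • ρ e) := by rw [hsq, neg_smul, one_smul, neg_neg]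
    _ = -B f (ρ e) • e := by rw [mul_smul, h, neg_smul]

/-- An equivariant map that scales the first member of a hyperbolic pair scales the second
member by the same factor. -/
lemma eq_smul_of_hyperbolic_pair (halt : B.IsAlt)
    (hequi : ∀ x y : M, ρ (x + B x y • y) = ρ x + B (ρ x) y • y)
    {e f : M} (hef : B e f = 1) {c : R} (he : ρ e = c • e) : ρ f = c • f := by
  have hfe : B f e = -1 := by rw [← halt.neg e f, hef]
  have hadd : ρ (e + f) = c • e + c • f := by
    simpa [hef, he] using hequi e f
  have h := hequi (e + f) e
  simpa [hadd, hfe, halt.self_eq_zero] using h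

end SymplecticQuandle


/-- If the characteristic of `R` is not 2 and `M` admits a hyperbolic pair
(`⟨e,f⟩ = 1`), then the symplectic quandle `(M,*)` has no good involution. -/
theorem no_good_involution_of_hyperbolic_pair
    (R : Type*) [CommRing R] (M : Type*) [AddCommGroup M] [Module R M]
    [Module.Free R M] [Module.Finite R M]
    (B : M →ₗ[R] M →ₗ[R] R) (halt : ∀ x : M, B x x = 0)
    (hchar : (2 : R) ≠ 0)
    (hhyp : ∃ e f : M, B e f = 1) :
    ¬ ∃ ρ : M → M, (∀ x : M, ρ (ρ x) = x) ∧
      (∀ x y : M, ρ (x + B x y • y) = ρ x + B (ρ x) y • y) ∧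
      (∀ x y : M, x + B x (ρ y) • ρ y = x - B x y • y) := by
  rintro ⟨ρ, hinv, hequi, hdual⟩
  obtain ⟨e, f, hef⟩ := hhyp
  have hB : B.IsAlt := halt
  have hfe : B f e = -1 := by rw [← hB.neg e f, hef]
  obtain ⟨c, hc, he⟩ := exists_eq_smul_of_hyperbolic_pair hB hdual hef
  -- Successive members of `e`, `e + f`, `(c - 1) • e + c • f`, `c • e` form hyperbolic pairs.
  have h₁ : ρ (e + f) = c • (e + f) :=
    eq_smul_of_hyperbolic_pair hB hequi (by simp [halt, hef]) he
  have h₂ : ρ ((c - 1) • e + c • f) = c • ((c - 1) • e + c • f) :=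
    eq_smul_of_hyperbolic_pair hB hequi (by simp [halt, hef, hfe]) h₁
  have h₃ : ρ (c • e) = c • c • e :=
    eq_smul_of_hyperbolic_pair hB hequi (by simp [halt, hfe, hc]) h₂
  rw [← he, hinv, he, smul_smul, hc, neg_smul, one_smul] at h₃
  have h₄ : (1 : R) = -1 := by simpa [hef] using congrArg (B · f) h₃
  exact hchar (by linear_combination h₄)
end

section
/- Let K be a field with (2 : K) ≠ 0 (the characteristic of K is not 2) and V a finite dimensional K-vector space with a bilinear form ⟨,⟩ : V × V → K satisfying ⟨x,x⟩ = 0 for all x. If the form is nontrivial, i.e. there exist x,y ∈ V with ⟨x,y⟩ ≠ 0, then there exists no good involution of the symplectic quandle (V,*). -/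
/-- If `-1 = d ^ 2` is a square and `2 ≠ 0`, then every element of `K` is a sum of two squares, so a
map commuting with the translations `x ↦ x + B x y • y` commutes with all `x ↦ x + (a * B x y) • y`. -/
theorem map_transvection_of_map_quandle_op {K V : Type*} [Field K] [AddCommGroup V] [Module K V]
    (B : V →ₗ[K] V →ₗ[K] K) (halt : ∀ x : V, B x x = 0) (h2 : (2 : K) ≠ 0) {d : K}
    (hd : d * d = -1) (ρ : V → V)
    (hρ : ∀ x y : V, ρ (x + B x y • y) = ρ x + B (ρ x) y • y) (x y : V) (a : K) :
    ρ (x + (a * B x y) • y) = ρ x + (a * B (ρ x) y) • y := by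
  have hsq (x : V) (s : K) : ρ (x + (s * s * B x y) • y) = ρ x + (s * s * B (ρ x) y) • y := by
    have h := hρ x (s • y)
    simp only [map_smul, smul_smul, smul_eq_mul] at h
    rwa [mul_right_comm s s, mul_right_comm s s]
  have ha : a = (a + 1) / 2 * ((a + 1) / 2) + d * (a - 1) / 2 * (d * (a - 1) / 2) := by
    field_simp
    linear_combination -(a - 1) ^ 2 * hd
  have h := hsq (x + ((a + 1) / 2 * ((a + 1) / 2) * B x y) • y) (d * (a - 1) / 2)
  rw [hsq x] at h
  simp only [map_add, map_smul, LinearMap.add_apply, LinearMap.smul_apply, halt, smul_zero,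
    add_zero] at h
  rw [add_assoc, add_assoc, ← add_smul, ← add_smul, ← add_mul, ← add_mul, ← ha] at h
  exact h


/-- If `K` is a field of characteristic not 2 and the antisymmetric bilinear
form on a finite dimensional `K`-vector space `V` is nontrivial, then the symplectic
quandle `(V,*)` has no good involution. -/
theorem no_good_involution_of_nontrivial_form_field
    (K : Type*) [Field K] (V : Type*) [AddCommGroup V] [Module K V]
    [FiniteDimensional K V]
    (B : V →ₗ[K] V →ₗ[K] K) (halt : ∀ x : V, B x x = 0)
    (hchar : (2 : K) ≠ 0)
    (hnontriv : ∃ x y : V, B x y ≠ 0) :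
    ¬ ∃ ρ : V → V, (∀ x : V, ρ (ρ x) = x) ∧
      (∀ x y : V, ρ (x + B x y • y) = ρ x + B (ρ x) y • y) ∧
      (∀ x y : V, x + B x (ρ y) • ρ y = x - B x y • y) := by
  rintro ⟨ρ, hinv, hop, hdual⟩
  obtain ⟨e, f, hb⟩ := hnontriv
  have hskew : B f e = -B e f := by
    have h := halt (e + f)
    simp only [map_add, LinearMap.add_apply, halt] at h
    linear_combination h
  have he : e ≠ 0 := by
    rintro rfl
    simp at hb
  have hfe : B f e ≠ 0 := by rwa [hskew, neg_ne_zero]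
  have hdual' (x : V) : B x (ρ e) • ρ e = -(B x e • e) :=
    add_left_cancel ((hdual x e).trans (sub_eq_add_neg _ _))
  have hne : B f (ρ e) ≠ 0 := by
    intro h
    have h' := hdual' f
    rw [h, zero_smul, eq_comm, neg_eq_zero, smul_eq_zero] at h'
    exact h'.elim hfe he
  obtain ⟨d, hρe⟩ : ∃ d : K, ρ e = d • e := by
    refine ⟨-((B f (ρ e))⁻¹ * B f e), ?_⟩
    rw [neg_smul, mul_smul, ← smul_neg, ← hdual' f, inv_smul_smul₀ hne]
  have hd : d * d = -1 := by
    have h := hdual' f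
    rw [hρe, map_smul, smul_smul, ← neg_smul, smul_eq_mul] at h
    have h' := smul_left_injective K he h
    apply mul_left_cancel₀ hfe
    linear_combination h'
  have hd0 : d ≠ 0 := by
    rintro rfl
    simp at hd
  have htrans := map_transvection_of_map_quandle_op B halt hchar hd ρ hop
  have h₁ : ρ (e + f) = d • (e + f) := by
    have h := htrans e f (B e f)⁻¹
    simp only [hρe, map_smul, LinearMap.smul_apply, smul_eq_mul, inv_mul_cancel₀ hb, one_smul] at h
    rw [h, mul_left_comm, inv_mul_cancel₀ hb, mul_one, smul_add]
  have h₂ : ρ (d • e + f) = d • (d • e + f) := by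
    have h := htrans (e + f) e ((1 - d) * (B e f)⁻¹)
    simp only [h₁, map_smul, map_add, LinearMap.add_apply, LinearMap.smul_apply, smul_eq_mul, halt,
      hskew, zero_add] at h
    convert h using 1
    · congr 1
      match_scalars <;> field_simp
      ring
    · match_scalars <;> field_simp
      ring
  have h₃ : ρ (d • e) = d • d • e := by
    have h := htrans (d • e + f) f (-(d * B e f)⁻¹)
    simp only [h₂, map_smul, map_add, LinearMap.add_apply, LinearMap.smul_apply, smul_eq_mul, halt,
      add_zero] at h
    convert h using 1
    · congr 1
      match_scalars <;> field_simp
      ring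
    · match_scalars <;> field_simp
      ring
  rw [← hρe, hinv, hρe, smul_smul, hd, neg_one_smul] at h₃
  have h : (2 : K) • e = 0 := by
    rw [two_smul]
    nth_rewrite 1 [h₃]
    exact neg_add_cancel e
  exact (smul_eq_zero.mp h).elim hchar he
end

section
/- Let R be a commutative ring with identity such that (2 : R) ≠ 0 (the characteristic of R is not 2), and let M be a nonzero finite rank free R-module with a bilinear form ⟨,⟩ : M × M → R satisfying ⟨x,x⟩ = 0 for all x. If the form is unimodular, i.e. the map M → M^∨ sending x to ⟨x,−⟩ is bijective onto the dual module M^∨, then there exists no good involution of the symplectic quandle (M,*). -/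
/-- If `⟨x, x'⟩ = 1`, then `x' = x * (x' - x)`, so a map commuting with the quandle operation
scales `x` and `x'` by the same factor. -/
theorem map_eq_smul_of_pairing_eq_one {R M : Type*} [CommRing R] [AddCommGroup M] [Module R M]
    {B : M →ₗ[R] M →ₗ[R] R} (halt : ∀ x : M, B x x = 0) {ρ : M → M}
    (hρ : ∀ x y : M, ρ (x + B x y • y) = ρ x + B (ρ x) y • y)
    {x x' : M} {a : R} (h : B x x' = 1) (hx : ρ x = a • x) : ρ x' = a • x' := by
  have h1 : B x (x' - x) = 1 := by rw [map_sub, h, halt, sub_zero]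
  have h2 := hρ x (x' - x)
  rw [hx, map_smul, LinearMap.smul_apply, h1, one_smul, add_sub_cancel, smul_eq_mul,
    mul_one] at h2
  rw [h2, ← smul_add, add_sub_cancel]

/-- A unimodular form on a nonzero free module admits vectors pairing to `1`. -/
theorem exists_pairing_eq_one {R M : Type*} [CommRing R] [AddCommGroup M] [Module R M]
    [Module.Free R M] [Nontrivial M] {B : M →ₗ[R] M →ₗ[R] R}
    (hB : Function.Surjective (fun x : M => (B x : M →ₗ[R] R))) : ∃ x y : M, B x y = 1 := by
  let b := Module.Free.chooseBasis R M
  obtain ⟨i⟩ := b.index_nonempty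
  obtain ⟨z, hz⟩ := hB (b.coord i)
  exact ⟨z, b i, by simpa using LinearMap.congr_fun hz (b i)⟩

/-- If the characteristic of `R` is not 2 and the antisymmetric bilinear form
on the nonzero finite rank free `R`-module `M` is unimodular (the map `M → M^∨`,
`x ↦ ⟨x,-⟩`, is bijective), then the symplectic quandle `(M,*)` has no good involution. -/
theorem no_good_involution_of_unimodular
    (R : Type*) [CommRing R] (M : Type*) [AddCommGroup M] [Module R M]
    [Module.Free R M] [Module.Finite R M] [Nontrivial M]
    (B : M →ₗ[R] M →ₗ[R] R) (halt : ∀ x : M, B x x = 0)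
    (hchar : (2 : R) ≠ 0)
    (hunimodular : Function.Bijective (fun x : M => (B x : M →ₗ[R] R))) :
    ¬ ∃ ρ : M → M, (∀ x : M, ρ (ρ x) = x) ∧
      (∀ x y : M, ρ (x + B x y • y) = ρ x + B (ρ x) y • y) ∧
      (∀ x y : M, x + B x (ρ y) • ρ y = x - B x y • y) := by
  rintro ⟨ρ, hinv, hmul, hdual⟩
  obtain ⟨f, e, hfe⟩ := exists_pairing_eq_one hunimodular.surjective
  have hef : B e f = -1 := by rw [← hfe, LinearMap.IsAlt.neg halt]
  obtain ⟨a, ha⟩ : ∃ a, B f (ρ e) = a := ⟨_, rfl⟩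
  have h1 : a • ρ e = -e := by
    have h := hdual f e
    rwa [ha, hfe, one_smul, sub_eq_add_neg, add_right_inj] at h
  have h2 : a * a = -1 := by
    have h := congrArg (B f) h1
    rwa [map_smul, map_neg, ha, hfe, smul_eq_mul] at h
  have h3 : ρ e = a • e := by
    have h := congrArg (a • ·) h1
    simp only [smul_smul, h2, smul_neg, neg_smul, one_smul, neg_inj] at h
    exact h
  -- `e`, `-f`, `-e - a f` and `a e` are successively related by pairings equal to `1`.
  have h4 : ρ (-f) = a • -f :=
    map_eq_smul_of_pairing_eq_one halt hmul (by simp [hef]) h3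
  have h5 : ρ (-e - a • f) = a • (-e - a • f) :=
    map_eq_smul_of_pairing_eq_one halt hmul (by simp [hfe, halt]) h4
  have h6 : ρ (a • e) = a • a • e :=
    map_eq_smul_of_pairing_eq_one halt hmul (by simp [hfe, halt, h2]) h5
  rw [← h3, hinv, h3, smul_smul, h2] at h6
  have h7 := congrArg (B f) h6
  rw [map_smul, hfe, smul_eq_mul, mul_one] at h7
  exact hchar (by linear_combination h7)
end

section
/- Let R = ℤ[i] be the ring of Gaussian integers and M = R² the rank two free R-module, equipped with the antisymmetric bilinear form ⟨(a,b),(c,d)⟩ := 3(ad − bc). Then there exists a good involution ρ : M → M of the symplectic quandle (M,*) defined by x*y := x + ⟨x,y⟩y. (Note that (M,*) is not a kei and ρ is not R-linear.) -/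
namespace GaussianQuandle

/-- Reduction modulo `3` of the four integer coordinates of a vector in `ℤ[i]²`. -/
def reduction (x : GaussianInt × GaussianInt) : (ZMod 3 × ZMod 3) × (ZMod 3 × ZMod 3) :=
  ((x.1.re, x.1.im), (x.2.re, x.2.im))

/-- A set of representatives, stable under negation, for multiplication by `i` on `𝔽₉ˣ / {±1}`. -/
def PositiveScalar (u : ZMod 3 × ZMod 3) : Prop :=
  (u.1 ≠ 0 ∧ u.2 = 0) ∨ u.1 * u.2 = 1

/-- The first nonzero coordinate of a vector in `𝔽₉²` is positive. -/
def PositiveResidue (v : (ZMod 3 × ZMod 3) × (ZMod 3 × ZMod 3)) : Prop :=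
  PositiveScalar v.1 ∨ (v.1 = 0 ∧ PositiveScalar v.2)

instance : DecidablePred PositiveScalar := fun u => by unfold PositiveScalar; infer_instance

instance : DecidablePred PositiveResidue := fun v => by unfold PositiveResidue; infer_instance

/-- Multiplication by `i` on `𝔽₉²`. -/
def rotate (v : (ZMod 3 × ZMod 3) × (ZMod 3 × ZMod 3)) : (ZMod 3 × ZMod 3) × (ZMod 3 × ZMod 3) :=
  ((-v.1.2, v.1.1), (-v.2.2, v.2.1))

set_option maxRecDepth 10000 in
theorem positiveResidue_rotate :
    ∀ v, v ≠ 0 → (PositiveResidue (rotate v) ↔ ¬ PositiveResidue v) := by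
  decide

set_option maxRecDepth 10000 in
theorem PositiveResidue.neg : ∀ v, PositiveResidue v → PositiveResidue (-v) := by
  decide

set_option maxRecDepth 10000 in
theorem PositiveResidue.ne_zero : ∀ v, PositiveResidue v → v ≠ 0 := by
  decide

/-- The Gaussian integer `i`. -/
def imaginaryUnit : GaussianInt := ⟨0, 1⟩

theorem imaginaryUnit_mul_self : imaginaryUnit * imaginaryUnit = -1 := by
  decide

theorem imaginaryUnit_smul_smul (x : GaussianInt × GaussianInt) :
    imaginaryUnit • imaginaryUnit • x = -x := by
  rw [smul_smul, imaginaryUnit_mul_self, neg_one_smul]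

theorem reduction_imaginaryUnit_smul (x : GaussianInt × GaussianInt) :
    reduction (imaginaryUnit • x) = rotate (reduction x) := by
  simp [reduction, rotate, imaginaryUnit]

theorem reduction_neg (x : GaussianInt × GaussianInt) : reduction (-x) = -reduction x := by
  simp [reduction]

theorem reduction_add (x y : GaussianInt × GaussianInt) :
    reduction (x + y) = reduction x + reduction y := by
  simp [reduction]

theorem reduction_three_smul (x : GaussianInt × GaussianInt) :
    reduction ((3 : GaussianInt) • x) = 0 := by
  have h : (3 : ZMod 3) = 0 := by decide
  simp [reduction, h]

theorem exists_eq_three_smul {x : GaussianInt × GaussianInt} (hx : reduction x = 0) :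
    ∃ y, x = (3 : GaussianInt) • y := by
  obtain ⟨⟨a, b⟩, ⟨c, d⟩⟩ := x
  simp only [reduction, Prod.mk_eq_zero] at hx
  have h3 (n : ℤ) (h : (n : ZMod 3) = 0) : ∃ m, n = 3 * m :=
    (ZMod.intCast_zmod_eq_zero_iff_dvd n 3).mp h
  obtain ⟨⟨ha, hb⟩, hc, hd⟩ := hx
  obtain ⟨a, rfl⟩ := h3 a ha
  obtain ⟨b, rfl⟩ := h3 b hb
  obtain ⟨c, rfl⟩ := h3 c hc
  obtain ⟨d, rfl⟩ := h3 d hd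
  exact ⟨(⟨a, b⟩, ⟨c, d⟩), by ext <;> simp⟩

theorem exists_eq_three_pow_smul {x : GaussianInt × GaussianInt} (hx : x ≠ 0) :
    ∃ (k : ℕ) (y : GaussianInt × GaussianInt),
      x = (3 : GaussianInt) ^ k • y ∧ reduction y ≠ 0 := by
  induction hn : x.1.re.natAbs + x.1.im.natAbs + x.2.re.natAbs + x.2.im.natAbs
    using Nat.strong_induction_on generalizing x with
  | _ n ih =>
  by_cases h : reduction x = 0
  · obtain ⟨y, rfl⟩ := exists_eq_three_smul h
    have hy : y ≠ 0 := by rintro rfl; simp at hx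
    have hlt : y.1.re.natAbs + y.1.im.natAbs + y.2.re.natAbs + y.2.im.natAbs < n := by
      have hpos : ¬ (y.1.re = 0 ∧ y.1.im = 0 ∧ y.2.re = 0 ∧ y.2.im = 0) := by
        rintro ⟨h1, h2, h3, h4⟩
        exact hy (Prod.ext (Zsqrtd.ext h1 h2) (Zsqrtd.ext h3 h4))
      simp [Int.natAbs_mul] at hn
      omega
    obtain ⟨k, z, rfl, hz⟩ := ih _ hlt hy rfl
    exact ⟨k + 1, z, by rw [pow_succ', mul_smul], hz⟩
  · exact ⟨0, x, by simp, h⟩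

theorem three_pow_smul_injective (k : ℕ) :
    Function.Injective fun x : GaussianInt × GaussianInt => (3 : GaussianInt) ^ k • x := by
  have h : (3 : GaussianInt) ^ k ≠ 0 := pow_ne_zero k (by decide)
  intro x y hxy
  simp only [Prod.ext_iff, Prod.smul_fst, Prod.smul_snd, smul_eq_mul] at hxy
  exact Prod.ext (mul_left_cancel₀ h hxy.1) (mul_left_cancel₀ h hxy.2)

theorem eq_of_three_pow_smul_eq {k l : ℕ} {x y : GaussianInt × GaussianInt}
    (hx : reduction x ≠ 0) (hy : reduction y ≠ 0)
    (h : (3 : GaussianInt) ^ k • x = (3 : GaussianInt) ^ l • y) : x = y := by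
  wlog hkl : k ≤ l generalizing k l x y
  · exact (this hy hx h.symm (le_of_not_ge hkl)).symm
  obtain ⟨m, rfl⟩ := Nat.exists_eq_add_of_le hkl
  rw [pow_add, mul_smul] at h
  have hxy : x = (3 : GaussianInt) ^ m • y := three_pow_smul_injective k h
  cases m with
  | zero => simpa using hxy
  | succ m =>
    rw [pow_succ', mul_smul] at hxy
    exact absurd (hxy ▸ reduction_three_smul _) hx

/-- After removing all factors of `3`, the vector has a positive residue modulo `3`. -/
def Positive (x : GaussianInt × GaussianInt) : Prop :=
  ∃ (k : ℕ) (y : GaussianInt × GaussianInt),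
    x = (3 : GaussianInt) ^ k • y ∧ PositiveResidue (reduction y)

theorem Positive.neg {x : GaussianInt × GaussianInt} (hx : Positive x) : Positive (-x) := by
  obtain ⟨k, y, rfl, hy⟩ := hx
  exact ⟨k, -y, by rw [smul_neg], by rw [reduction_neg]; exact hy.neg⟩

theorem positive_imaginaryUnit_smul {x : GaussianInt × GaussianInt} (hx : x ≠ 0) :
    Positive (imaginaryUnit • x) ↔ ¬ Positive x := by
  obtain ⟨k, y, rfl, hy⟩ := exists_eq_three_pow_smul hx
  have key {k : ℕ} {y : GaussianInt × GaussianInt} (hy : reduction y ≠ 0) :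
      Positive ((3 : GaussianInt) ^ k • y) ↔ PositiveResidue (reduction y) := by
    refine ⟨?_, fun h => ⟨k, y, rfl, h⟩⟩
    rintro ⟨l, z, h, hz⟩
    rwa [eq_of_three_pow_smul_eq hy hz.ne_zero h]
  have hiy : reduction (imaginaryUnit • y) ≠ 0 := by
    rw [reduction_imaginaryUnit_smul]
    simpa [rotate, Prod.ext_iff, and_comm] using hy
  rw [smul_comm, key hiy, key hy, reduction_imaginaryUnit_smul, positiveResidue_rotate _ hy]

theorem Positive.transvection {x : GaussianInt × GaussianInt} (hx : Positive x)
    (y : GaussianInt × GaussianInt) :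
    Positive (x + (3 * (x.1 * y.2 - x.2 * y.1)) • y) := by
  obtain ⟨k, z, rfl, hz⟩ := hx
  refine ⟨k, z + (3 : GaussianInt) • (z.1 * y.2 - z.2 * y.1) • y, ?_, ?_⟩
  · apply Prod.ext <;> simp only [Prod.fst_add, Prod.snd_add, Prod.smul_fst, Prod.smul_snd,
      smul_eq_mul] <;> ring
  · rwa [reduction_add, reduction_three_smul, add_zero]

theorem positive_transvection_iff (x y : GaussianInt × GaussianInt) :
    Positive (x + (3 * (x.1 * y.2 - x.2 * y.1)) • y) ↔ Positive x := by
  refine ⟨fun h => ?_, fun h => h.transvection y⟩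
  convert h.transvection (imaginaryUnit • y) using 1
  have hi := imaginaryUnit_mul_self
  apply Prod.ext <;> simp only [Prod.fst_add, Prod.snd_add, Prod.smul_fst, Prod.smul_snd,
    smul_eq_mul]
  · linear_combination (-3 * (x.1 * y.2 - x.2 * y.1) * y.1) * hi
  · linear_combination (-3 * (x.1 * y.2 - x.2 * y.1) * y.2) * hi

open Classical in
/-- Multiplication by `i` on positive vectors and by `-i` on the others. -/
noncomputable def goodInvolution (x : GaussianInt × GaussianInt) : GaussianInt × GaussianInt :=
  if Positive x then imaginaryUnit • x else -(imaginaryUnit • x)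

theorem goodInvolution_goodInvolution (x : GaussianInt × GaussianInt) :
    goodInvolution (goodInvolution x) = x := by
  rcases eq_or_ne x 0 with rfl | hx
  · have h0 : goodInvolution 0 = 0 := by simp [goodInvolution]
    rw [h0, h0]
  · have hi := positive_imaginaryUnit_smul hx
    by_cases h : Positive x
    · have h' : ¬ Positive (imaginaryUnit • x) := fun h' => hi.mp h' h
      simp [goodInvolution, h, h', imaginaryUnit_smul_smul]
    · have h' : Positive (-(imaginaryUnit • x)) := (hi.mpr h).neg
      simp [goodInvolution, h, h', imaginaryUnit_smul_smul]

end GaussianQuandle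

open GaussianQuandle

/-- On `M = ℤ[i]²` with the antisymmetric bilinear form
`⟨(a,b),(c,d)⟩ = 3(ad - bc)`, the symplectic quandle `x*y = x + ⟨x,y⟩•y` admits a good
involution. -/
theorem gaussian_symplectic_quandle_has_good_involution :
    ∃ ρ : GaussianInt × GaussianInt → GaussianInt × GaussianInt,
      (∀ x, ρ (ρ x) = x) ∧
      (∀ x y : GaussianInt × GaussianInt,
        ρ (x + (3 * (x.1 * y.2 - x.2 * y.1)) • y)
          = ρ x + (3 * ((ρ x).1 * y.2 - (ρ x).2 * y.1)) • y) ∧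
      (∀ x y : GaussianInt × GaussianInt,
        x + (3 * (x.1 * (ρ y).2 - x.2 * (ρ y).1)) • ρ y
          = x - (3 * (x.1 * y.2 - x.2 * y.1)) • y) := by
  refine ⟨goodInvolution, goodInvolution_goodInvolution, fun x y => ?_, fun x y => ?_⟩
  · have h := positive_transvection_iff x y
    by_cases hx : Positive x <;> simp only [goodInvolution, h, hx, if_true, if_false] <;>
      apply Prod.ext <;> simp only [Prod.fst_add, Prod.snd_add, Prod.fst_neg,
      Prod.snd_neg, Prod.smul_fst, Prod.smul_snd, smul_eq_mul] <;> ring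
  · have hi := imaginaryUnit_mul_self
    simp only [goodInvolution]
    split_ifs <;> apply Prod.ext <;> simp only [Prod.fst_add, Prod.snd_add, Prod.fst_neg,
      Prod.snd_neg, Prod.fst_sub, Prod.snd_sub, Prod.smul_fst, Prod.smul_snd, smul_eq_mul]
    all_goals first
      | linear_combination (3 * (x.1 * y.2 - x.2 * y.1) * y.1) * hi
      | linear_combination (3 * (x.1 * y.2 - x.2 * y.1) * y.2) * hi
end

section
/- Let R = ℤ/9ℤ and M = R² the rank two free R-module, equipped with the antisymmetric bilinear form ⟨(a,b),(c,d)⟩ := 3(ad − bc). Then the module M has no hyperbolic pair (there are no x,y ∈ M with ⟨x,y⟩ = 1), and nevertheless the symplectic quandle (M,*) defined by x*y := x + ⟨x,y⟩y has no good involution. -/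
/-- On `M = (ℤ/9ℤ)²` with the antisymmetric bilinear form
`⟨(a,b),(c,d)⟩ = 3(ad - bc)`, the module `M` has no hyperbolic pair, and the symplectic
quandle `x*y = x + ⟨x,y⟩•y` has no good involution. -/
theorem zmod9_symplectic_quandle_no_hyperbolic_pair_no_good_involution :
    (¬ ∃ x y : ZMod 9 × ZMod 9, 3 * (x.1 * y.2 - x.2 * y.1) = 1) ∧
    (¬ ∃ ρ : ZMod 9 × ZMod 9 → ZMod 9 × ZMod 9,
      (∀ x, ρ (ρ x) = x) ∧
      (∀ x y : ZMod 9 × ZMod 9,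
        ρ (x + (3 * (x.1 * y.2 - x.2 * y.1)) • y)
          = ρ x + (3 * ((ρ x).1 * y.2 - (ρ x).2 * y.1)) • y) ∧
      (∀ x y : ZMod 9 × ZMod 9,
        x + (3 * (x.1 * (ρ y).2 - x.2 * (ρ y).1)) • ρ y
          = x - (3 * (x.1 * y.2 - x.2 * y.1)) • y)) := by
  constructor
  · rintro ⟨x, y, h⟩
    have key : ∀ t : ZMod 9, 3 * t ≠ 1 := by decide
    exact key _ h
  · rintro ⟨ρ, -, -, h⟩
    -- Testing `y = (1, 0)` against `x = (0, 1)` would make `-1` a square modulo `3`.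
    have key : ∀ p : ZMod 9, -(3 * p * p) ≠ 3 := by decide
    have h₁ := congrArg Prod.fst (h (0, 1) (1, 0))
    simp only [Prod.fst_add, Prod.fst_sub, Prod.smul_fst, smul_eq_mul] at h₁
    exact key (ρ (1, 0)).1 (by linear_combination h₁)
end
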